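/- Let q be a prime power, k,r ≥ 2, and U ⊆ F_{q^k}^r the F_q-subspace U = {(s, s^q, …, s^{q^{r-1}}) : s ∈ F_{q^k}}. Then the family {σ_a : a ∈ F_{q^k}, N_{F_{q^k}/F_q}(a) = 1}, with σ_a = {(s, a s, s^{q^2}, …, s^{q^{r-1}}) : s ∈ F_{q^k}}, is a collection of (q^k-1)/(q-1) pairwise trivially intersecting F_q-subspaces of F_q-dimension k, each meeting U in F_q-dimension exactly 1. -/

import Mathlib

open Module

/-- The `q`-system `U = {(s, s^q, s^{q^2}, …, s^{q^{r-1}}) : s ∈ K}` (as a set). -/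
def uSet (F K : Type*) [Field F] [Fintype F] [Field K] (r : ℕ) : Set (Fin r → K) :=
  Set.range fun s : K => fun i : Fin r => s ^ Fintype.card F ^ (i : ℕ)

/-- The set `σ_a = {(s, a s, s^{q^2}, …, s^{q^{r-1}}) : s ∈ K}`. -/
def sigmaSet (F K : Type*) [Field F] [Fintype F] [Field K] (r : ℕ) (a : K) :
    Set (Fin r → K) :=
  Set.range fun s : K => fun i : Fin r =>
    if (i : ℕ) = 1 then a * s else s ^ Fintype.card F ^ (i : ℕ)


lemma aux_fixed (F K : Type*) [Field F] [Fintype F] [Field K] [Algebra F K]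
    [FiniteDimensional F K] (x : K) (hx : x ^ Fintype.card F = x) :
    ∃ c : F, algebraMap F K c = x := by
  have : Finite K := Module.finite_of_finite F
  have h : x ∈ (⊥ : IntermediateField F K) := by
    rw [IsGalois.mem_bot_iff_fixed]
    intro f
    obtain ⟨n, rfl⟩ := (FiniteField.bijective_frobeniusAlgEquivOfAlgebraic_pow F K).2 f
    simp only [AlgEquiv.coe_pow]
    exact Function.iterate_fixed (by simpa using hx) _
  simpa [IntermediateField.mem_bot] using h

lemma aux_card (F K : Type*) [Field F] [Fintype F] [Field K] [Algebra F K]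
    [FiniteDimensional F K] :
    Nat.card {a : K // Algebra.norm F a = 1} =
      (Fintype.card F ^ finrank F K - 1) / (Fintype.card F - 1) := by
  have : Finite K := Module.finite_of_finite F
  let f : Kˣ →* Fˣ := Units.map (Algebra.norm F (S := K))
  have hs : Function.Surjective f := FiniteField.unitsMap_norm_surjective F K
  have h1 : Nat.card f.ker * (Fintype.card F - 1) = Fintype.card F ^ finrank F K - 1 := by
    have h := f.ker.card_mul_index
    rw [Subgroup.index_ker, MonoidHom.range_eq_top.2 hs, Subgroup.card_top, Nat.card_units,
      Nat.card_units, Module.natCard_eq_pow_finrank (K := F) (V := K),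
      Nat.card_eq_fintype_card (α := F)] at h
    exact h
  have h2 : Nat.card {a : K // Algebra.norm F a = 1} = Nat.card f.ker := by
    refine Nat.card_congr (Equiv.ofBijective (fun a : f.ker => (⟨((a : Kˣ) : K), ?_⟩ :
      {a : K // Algebra.norm F a = 1})) ⟨?_, ?_⟩).symm
    · exact congrArg Units.val a.2
    · intro a b hab
      exact Subtype.ext (Units.ext (congrArg Subtype.val hab))
    · rintro ⟨a, ha⟩
      have ha0 : a ≠ 0 := by
        rintro rfl
        simp at ha
      exact ⟨⟨Units.mk0 a ha0, Units.ext ha⟩, rfl⟩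
  have h3 : 1 < Fintype.card F := Fintype.one_lt_card
  rw [h2, ← h1, Nat.mul_div_cancel _ (by omega)]

lemma aux_hilbert (F K : Type*) [Field F] [Fintype F] [Field K] [Algebra F K]
    [FiniteDimensional F K] (a : K) (ha : Algebra.norm F a = 1) :
    ∃ s : K, s ≠ 0 ∧ s ^ Fintype.card F = a * s := by
  have : Finite K := Module.finite_of_finite F
  have h3 : 1 < Fintype.card F := Fintype.one_lt_card
  have ha0 : a ≠ 0 := by
    rintro rfl
    simp at ha
  obtain ⟨g, hg⟩ := IsCyclic.exists_monoid_generator (α := Kˣ)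
  obtain ⟨j, hj⟩ := hg (Units.mk0 a ha0)
  simp only at hj
  have hord : orderOf g = Nat.card K - 1 := by
    rw [← Nat.card_units]
    exact orderOf_eq_card_of_forall_mem_powers hg
  have hdvd : Fintype.card F - 1 ∣ Nat.card K - 1 := by
    rw [Module.natCard_eq_pow_finrank (K := F), Nat.card_eq_fintype_card]
    simpa using Nat.sub_dvd_pow_sub_pow (Fintype.card F) 1 (finrank F K)
  have hn := FiniteField.algebraMap_norm_eq_pow (K := F) (x := a)
  rw [ha, map_one, Nat.card_eq_fintype_card (α := F)] at hn
  obtain ⟨M, hM⟩ := hdvd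
  have hKpos : 0 < Nat.card K - 1 := by
    have := Finite.one_lt_card (α := K)
    omega
  have hMpos : 0 < M := by
    rcases Nat.eq_zero_or_pos M with h | h
    · subst h; omega
    · exact h
  rw [hM, Nat.mul_div_cancel_left _ (by omega)] at hn
  have h4 : g ^ (j * M) = 1 := by
    rw [pow_mul, hj]
    exact Units.ext hn.symm
  have h5 := orderOf_dvd_of_pow_eq_one h4
  rw [hord, hM] at h5
  obtain ⟨t, ht⟩ := Nat.dvd_of_mul_dvd_mul_right hMpos h5
  refine ⟨((g ^ t : Kˣ) : K), Units.ne_zero _, ?_⟩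
  have h6 : (g ^ t) ^ Fintype.card F = Units.mk0 a ha0 * g ^ t := by
    rw [← hj, ← pow_mul, ← pow_add, ht]
    congr 1
    obtain ⟨m, hm⟩ : ∃ m, Fintype.card F = m + 1 := ⟨Fintype.card F - 1, by omega⟩
    rw [hm]
    simp
    ring
  simpa using congrArg Units.val h6

/-- The linear map parametrizing `U`. -/
noncomputable def auxU (F K : Type*) [Field F] [Fintype F] [Field K] [Algebra F K] (r : ℕ) :
    K →ₗ[F] (Fin r → K) :=
  LinearMap.pi fun i => ((FiniteField.frobeniusAlgHom F K) ^ (i : ℕ)).toLinearMap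

/-- The linear map parametrizing `σ_a`. -/
noncomputable def auxS (F K : Type*) [Field F] [Fintype F] [Field K] [Algebra F K] (r : ℕ)
    (a : K) : K →ₗ[F] (Fin r → K) :=
  LinearMap.pi fun i => if (i : ℕ) = 1 then LinearMap.mulLeft F a else
    ((FiniteField.frobeniusAlgHom F K) ^ (i : ℕ)).toLinearMap

lemma auxU_apply (F K : Type*) [Field F] [Fintype F] [Field K] [Algebra F K] (r : ℕ)
    (s : K) (i : Fin r) : auxU F K r s i = s ^ Fintype.card F ^ (i : ℕ) := by
  simp [auxU, AlgHom.coe_pow, FiniteField.coe_frobeniusAlgHom, pow_iterate]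

lemma auxS_apply (F K : Type*) [Field F] [Fintype F] [Field K] [Algebra F K] (r : ℕ)
    (a s : K) (i : Fin r) : auxS F K r a s i =
      if (i : ℕ) = 1 then a * s else s ^ Fintype.card F ^ (i : ℕ) := by
  simp only [auxS, LinearMap.pi_apply]
  split_ifs
  · simp
  · simp [AlgHom.coe_pow, FiniteField.coe_frobeniusAlgHom, pow_iterate]

theorem stmt6 (F K : Type*) [Field F] [Fintype F] [Field K] [Algebra F K]
    [FiniteDimensional F K] (k r : ℕ) (hk : 2 ≤ k) (hr : 2 ≤ r)
    (hfr : finrank F K = k) :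
    Nat.card {a : K // Algebra.norm F a = 1} =
      (Fintype.card F ^ k - 1) / (Fintype.card F - 1) ∧
    ∃ (Usub : Submodule F (Fin r → K))
      (σ : {a : K // Algebra.norm F a = 1} → Submodule F (Fin r → K)),
      (Usub : Set (Fin r → K)) = uSet F K r ∧
      (∀ a, ((σ a : Submodule F (Fin r → K)) : Set (Fin r → K)) = sigmaSet F K r a) ∧
      (∀ a, finrank F (σ a) = k) ∧
      (∀ a b, a ≠ b → σ a ⊓ σ b = ⊥) ∧
      (∀ a, finrank F (Usub ⊓ σ a : Submodule F (Fin r → K)) = 1) := by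
  refine ⟨hfr ▸ aux_card F K, LinearMap.range (auxU F K r),
    fun a => LinearMap.range (auxS F K r a), ?_, ?_, ?_, ?_, ?_⟩
  · rw [LinearMap.coe_range, uSet]
    congr 1
    ext s i
    exact auxU_apply F K r s i
  · intro a
    rw [LinearMap.coe_range, sigmaSet]
    congr 1
    ext s i
    exact auxS_apply F K r a s i
  · intro a
    rw [LinearMap.finrank_range_of_inj, hfr]
    intro s t h
    have h0 := congrFun h ⟨0, by omega⟩
    simpa [auxS_apply] using h0
  · intro a b hab
    rw [eq_bot_iff]
    rintro x ⟨⟨s, rfl⟩, ⟨t, ht⟩⟩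
    have h0 := congrFun ht ⟨0, by omega⟩
    have h1 := congrFun ht ⟨1, by omega⟩
    simp only [auxS_apply] at h0 h1
    simp at h0 h1
    subst h0
    rcases mul_eq_mul_right_iff.1 h1 with h1 | h1
    · exact absurd (Subtype.ext h1.symm) hab
    · simp [h1]
  · intro a
    obtain ⟨s, hs0, hs⟩ := aux_hilbert F K a.1 a.2
    have hmem : auxU F K r s ∈ LinearMap.range (auxU F K r) ⊓ LinearMap.range (auxS F K r a) := by
      refine ⟨⟨s, rfl⟩, ⟨s, ?_⟩⟩
      ext i
      rw [auxU_apply, auxS_apply]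
      split_ifs with hi
      · rw [hi, pow_one, hs]
      · rfl
    refine finrank_eq_one (⟨auxU F K r s, hmem⟩ : ↥(LinearMap.range (auxU F K r) ⊓ LinearMap.range (auxS F K r a))) ?_ ?_
    · intro h
      have h0 := congrFun (congrArg Subtype.val h) ⟨0, by omega⟩
      simp [auxU_apply] at h0
      exact hs0 h0
    · rintro ⟨x, ⟨t, rfl⟩, ⟨w, ht⟩⟩
      have h0 := congrFun ht ⟨0, by omega⟩
      have h1 := congrFun ht ⟨1, by omega⟩
      simp only [auxS_apply, auxU_apply] at h0 h1
      simp at h0 h1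
      subst h0
      obtain ⟨c, hc⟩ := aux_fixed F K (w / s) (by
        rw [div_pow, hs, ← h1, mul_div_mul_left]
        intro h
        have := a.2
        rw [h] at this
        have hne : Nontrivial K := inferInstance
        simp at this)
      refine ⟨c, Subtype.ext ?_⟩
      change c • auxU F K r s = auxU F K r w
      rw [← map_smul, Algebra.smul_def, hc, div_mul_cancel₀ _ hs0]
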